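/- Let F be a field, and let X, Y be intermediate fields of an extension of F with compositum XY (the subfield generated by X ∪ Y). Then the transcendence degree satisfies trd(XY / Y) ≤ trd(X / X ∩ Y). (Submodularity of transcendence degree.) -/

import Mathlib

/-- The transcendence degree of `L` over `K`, for subfields `K ≤ L` of an ambient
field `Ω`: the supremum of the cardinalities of subsets of `L` that are
algebraically independent over `K`. -/
noncomputable def relTrdeg {Ω : Type*} [Field Ω] (K L : Subfield Ω) : Cardinal :=
  ⨆ s : {s : Set Ω // s ⊆ (L : Set Ω) ∧ AlgebraicIndependent K ((↑) : s → Ω)},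
    Cardinal.mk s.1

theorem isAlg_of_hom {R S A : Type*} [CommRing R] [CommRing S] [CommRing A] [Algebra R A]
    [Algebra S A] (g : R →+* S) (hg : Function.Injective g)
    (hcomp : ∀ x, algebraMap S A (g x) = algebraMap R A x) (a : A)
    (ha : IsAlgebraic R a) : IsAlgebraic S a := by
  obtain ⟨p, hp, hpa⟩ := ha
  refine ⟨p.map g, (Polynomial.map_ne_zero_iff hg).2 hp, ?_⟩
  have hc : (algebraMap S A).comp g = algebraMap R A := RingHom.ext hcomp
  rw [Polynomial.aeval_def, Polynomial.eval₂_map, hc, ← Polynomial.aeval_def]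
  exact hpa

theorem adjoin_mem_mono {Ω : Type*} [Field Ω] {k Y : Subfield Ω} (h : k ≤ Y) (t : Set Ω) (x : Ω)
    (hx : x ∈ Algebra.adjoin k t) : x ∈ Algebra.adjoin Y t := by
  induction hx using Algebra.adjoin_induction with
  | mem x hx => exact Algebra.subset_adjoin hx
  | algebraMap r => exact (Algebra.adjoin Y t).algebraMap_mem ⟨r.1, h r.2⟩
  | add x y _ _ hx hy => exact add_mem hx hy
  | mul x y _ _ hx hy => exact mul_mem hx hy

theorem isAlg_subalgebra {k Y Ω : Type*} [CommRing k] [CommRing Y] [CommRing Ω] [Algebra k Ω]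
    [Algebra Y Ω] (P : Subalgebra k Ω) (Q : Subalgebra Y Ω) (h : ∀ x ∈ P, x ∈ Q) (a : Ω)
    (ha : IsAlgebraic P a) : IsAlgebraic Q a :=
  isAlg_of_hom (Subring.inclusion (S := P.toSubring) (T := Q.toSubring) h)
    (fun x y hxy => Subtype.ext (by
      have h2 := congrArg Subtype.val hxy
      exact h2)) (fun _ => rfl) a ha

theorem isAlg_mono {Ω : Type*} [Field Ω] {k Y : Subfield Ω} (h : k ≤ Y) (t : Set Ω) (a : Ω)
    (ha : IsAlgebraic (Algebra.adjoin k t) a) : IsAlgebraic (Algebra.adjoin Y t) a :=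
  isAlg_subalgebra _ _ (adjoin_mem_mono h t) a ha

/-- Submodularity of transcendence degree: for intermediate fields `X`, `Y` of an
extension of `F`, with compositum `X ⊔ Y`, one has
`trd(XY / Y) ≤ trd(X / X ∩ Y)`. -/
theorem trdeg_submodular {Ω : Type*} [Field Ω] (F X Y : Subfield Ω)
    (hFX : F ≤ X) (hFY : F ≤ Y) :
    relTrdeg Y (X ⊔ Y) ≤ relTrdeg (X ⊓ Y) X := by
  obtain ⟨t, ht⟩ := (AlgebraicIndependent.matroid (X ⊓ Y : Subfield Ω) Ω).exists_isBasis (X : Set Ω)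
  obtain ⟨hind, htX, halg⟩ := AlgebraicIndependent.matroid_isBasis_iff.1 ht
  let Z : Subfield Ω :=
    { (Subalgebra.algebraicClosure (Algebra.adjoin Y t) Ω).toSubring with
      inv_mem' := fun x hx => IsAlgebraic.inv (R := Algebra.adjoin Y t) hx }
  have hZ : X ⊔ Y ≤ Z := by
    refine sup_le (fun x hx => ?_) (fun y hy => ?_)
    · exact isAlg_mono inf_le_right t x (halg x hx)
    · exact isAlgebraic_algebraMap (A := Ω)
        (⟨y, (Algebra.adjoin Y t).algebraMap_mem ⟨y, hy⟩⟩ : Algebra.adjoin Y t)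
  refine ciSup_le' fun s => ?_
  refine le_trans ?_ (le_ciSup (f := fun s : {s : Set Ω // s ⊆ (X : Set Ω) ∧
    AlgebraicIndependent (X ⊓ Y : Subfield Ω) ((↑) : s → Ω)} => Cardinal.mk s.1)
    Cardinal.bddAbove_of_small ⟨t, htX, hind⟩)
  have hsi : (AlgebraicIndependent.matroid Y Ω).Indep s.1 := s.2.2
  have h1 := hsi.cardinalMk_le_cRk_of_subset
    (X := (AlgebraicIndependent.matroid Y Ω).closure t) (by
      rw [AlgebraicIndependent.matroid_closure_eq]
      exact fun x hx => hZ (s.2.1 hx))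
  rw [Matroid.cRk_closure] at h1
  exact h1.trans (Matroid.cRk_le_cardinalMk _ _)
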